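/- Let f : B_ε(p) ⊆ ℝ^D → ℝ be C¹ with a saddle point p (a critical point that is neither a local extremum nor has a neighborhood on which f = f(p)), c = f(p), and suppose δ ∈ (0,ε) is such that the level set f⁻¹(c) intersects the sphere ∂B_δ(p) transversally (i.e., at every s ∈ ∂B_δ(p) ∩ f⁻¹(c), ∇f(s) is not collinear with s − p). Suppose f_n → f with ∇f_n → ∇f uniformly, each f_n has p_n as its unique critical point in B_δ(p), p_n → p, and each p_n is a local maximum of f_n. Then a contradiction follows; i.e., a sequence of unique local maxima of f_n converging in C¹ cannot limit onto such a transversally-cut saddle point of f. -/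

import Mathlib

open Filter Topology Metric

section MountainPass

variable {E : Type*} [NormedAddCommGroup E] [NormedSpace ℝ E]

/-- A `C¹` function increases along a short Euler step in direction `w x - x`, uniformly near a
point where the derivative in that direction is positive. -/
theorem eventually_lt_apply_add_smul {g : E → ℝ} (hg : ContDiff ℝ 1 g) {w : E → E}
    (hw : Continuous w) {x₀ : E} (hx₀ : 0 < fderiv ℝ g x₀ (w x₀ - x₀)) :
    ∀ᶠ z : ℝ × E in 𝓝 (0, x₀), 0 < z.1 → g z.2 < g (z.2 + z.1 • (w z.2 - z.2)) := by
  have hg' : Continuous (fderiv ℝ g) := hg.continuous_fderiv one_ne_zero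
  have hcont : Continuous fun z : ℝ × E =>
      fderiv ℝ g (z.2 + z.1 • (w z.2 - z.2)) (w z.2 - z.2) := by fun_prop
  have hpos : ∀ᶠ z : ℝ × E in 𝓝 (0, x₀),
      0 < fderiv ℝ g (z.2 + z.1 • (w z.2 - z.2)) (w z.2 - z.2) :=
    hcont.continuousAt.eventually (lt_mem_nhds (by simpa using hx₀))
  obtain ⟨r, hr, hball⟩ := Metric.eventually_nhds_iff.1 hpos
  refine Metric.eventually_nhds_iff.2 ⟨r, hr, ?_⟩
  rintro ⟨τ, x⟩ hz hτ
  simp only at hτ ⊢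
  obtain ⟨y, hy, hmvt⟩ := domain_mvt (f := g) (s := Set.univ) (x := x) (y := x + τ • (w x - x))
    (f' := fderiv ℝ g)
    (fun y _ => ((hg.differentiable one_ne_zero) y).hasFDerivAt.hasFDerivWithinAt)
    convex_univ trivial trivial
  rw [segment_eq_image'] at hy
  obtain ⟨θ, ⟨hθ₀, hθ₁⟩, rfl⟩ := hy
  have hdist : dist ((θ * τ, x) : ℝ × E) (0, x₀) < r := by
    refine lt_of_le_of_lt ?_ hz
    simp only [Prod.dist_eq, Real.dist_eq, sub_zero]
    refine max_le_max ?_ le_rfl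
    rw [abs_of_pos hτ, abs_of_nonneg (by positivity)]
    nlinarith
  have h := hball hdist
  simp only [add_sub_cancel_left, smul_smul, map_smul, smul_eq_mul] at hmvt h
  nlinarith [mul_pos hτ h]

/-- If no point of the compact convex set `K` at level `m` is critical for `g` relative to `K`, then
there is a continuous choice of points of `K` towards which `g` increases along the level set,
fixing two prescribed points off the level set. -/
theorem exists_continuous_ascent_target {K : Set E} (hKc : IsCompact K) (hK : Convex ℝ K)
    {g : E → ℝ} (hg : ContDiff ℝ 1 g) {a b : E} (ha : a ∈ K) (hb : b ∈ K) {m : ℝ}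
    (hma : g a ≠ m) (hmb : g b ≠ m)
    (hcrit : ∀ s ∈ K, g s = m → ∃ v ∈ K, 0 < fderiv ℝ g s (v - s)) :
    ∃ w : C(E, E), w a = a ∧ w b = b ∧ (∀ x, w x ∈ K) ∧
      ∀ x ∈ K, g x = m → 0 < fderiv ℝ g x (w x - x) := by
  have hg' : Continuous (fderiv ℝ g) := hg.continuous_fderiv one_ne_zero
  let t : E → Set E := fun x => {v | v ∈ K ∧ (x ∈ K → g x = m → 0 < fderiv ℝ g x (v - x)) ∧
    (x ∈ ({a, b} : Set E) → v = x)}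
  have ht : ∀ x, Convex ℝ (t x) := by
    rintro x v ⟨hv, hv', hv''⟩ u ⟨hu, hu', hu''⟩ α β hα hβ hαβ
    refine ⟨hK hv hu hα hβ hαβ, fun hx hxm => ?_, fun hx => ?_⟩
    · have e : α • v + β • u - x = α • (v - x) + β • (u - x) := by
        rw [smul_sub, smul_sub]
        nth_rewrite 1 [← one_smul ℝ x]
        rw [← hαβ, add_smul]
        abel
      rw [e, map_add, map_smul, map_smul, smul_eq_mul, smul_eq_mul]
      have h₁ := hv' hx hxm
      have h₂ := hu' hx hxm
      rcases hα.eq_or_lt with rfl | hα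
      · have : β = 1 := by linarith
        subst this
        simpa using h₂
      · have := mul_pos hα h₁
        have := mul_nonneg hβ h₂.le
        linarith
    · rw [hv'' hx, hu'' hx, ← add_smul, hαβ, one_smul]
  have hisol : ∀ x, ∀ᶠ y in 𝓝 x, y ∈ ({a, b} : Set E) → y = x := by
    intro x
    have hfin : ((({a, b} : Set E) \ {x})).Finite := (Set.toFinite _).subset Set.sdiff_subset
    filter_upwards [hfin.isClosed.isOpen_compl.mem_nhds (by simp : x ∈ ({a, b} \ {x} : Set E)ᶜ)]
      with y hy hyab
    by_contra hne
    exact hy ⟨hyab, hne⟩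
  have hloc : ∀ x, ∃ v, ∀ᶠ y in 𝓝 x, v ∈ t y := by
    intro x
    by_cases hx : x ∈ K ∧ g x = m
    · obtain ⟨v, hv, hpos⟩ := hcrit x hx.1 hx.2
      have hcont : Continuous fun y => fderiv ℝ g y (v - y) := by fun_prop
      have hxab : x ∉ ({a, b} : Set E) := by
        rintro (rfl | rfl)
        · exact hma hx.2
        · exact hmb hx.2
      refine ⟨v, ?_⟩
      filter_upwards [hcont.continuousAt.eventually (lt_mem_nhds hpos), hisol x] with y hy hy'
      exact ⟨hv, fun _ _ => hy, fun hyab => absurd (hy' hyab ▸ hyab) hxab⟩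
    · have hclosed : IsClosed {y | y ∈ K ∧ g y = m} :=
        hKc.isClosed.inter (isClosed_eq hg.continuous continuous_const)
      have hev : ∀ᶠ y in 𝓝 x, ¬ (y ∈ K ∧ g y = m) := hclosed.isOpen_compl.mem_nhds hx
      by_cases hxab : x ∈ ({a, b} : Set E)
      · have hxK : x ∈ K := by
          rcases hxab with rfl | rfl
          · exact ha
          · exact hb
        refine ⟨x, ?_⟩
        filter_upwards [hev, hisol x] with y hy hy'
        exact ⟨hxK, fun h₁ h₂ => absurd ⟨h₁, h₂⟩ hy, fun h => (hy' h).symm⟩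
      · refine ⟨a, ?_⟩
        filter_upwards [hev, hisol x] with y hy hy'
        exact ⟨ha, fun h₁ h₂ => absurd ⟨h₁, h₂⟩ hy, fun h => absurd (hy' h ▸ h) hxab⟩
  obtain ⟨w, hw⟩ := exists_continuous_forall_mem_convex_of_local_const ht hloc
  exact ⟨w, (hw a).2.2 (by simp), (hw b).2.2 (by simp), fun x => (hw x).1, fun x => (hw x).2.1⟩

/-- If no point of the compact convex set `K` at level `m` is critical for `g` relative to `K`, then
a continuous self-map of `K` pushes a superlevel set of `g` slightly below `m` to one
above `m`, fixing two prescribed points off the level set. -/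
theorem exists_continuous_deformation {K : Set E} (hKc : IsCompact K) (hK : Convex ℝ K)
    {g : E → ℝ} (hg : ContDiff ℝ 1 g) {a b : E} (ha : a ∈ K) (hb : b ∈ K) {m : ℝ}
    (hma : g a ≠ m) (hmb : g b ≠ m)
    (hcrit : ∀ s ∈ K, g s = m → ∃ v ∈ K, 0 < fderiv ℝ g s (v - s)) :
    ∃ Φ : E → E, Continuous Φ ∧ Set.MapsTo Φ K K ∧ Φ a = a ∧ Φ b = b ∧
      ∃ η > 0, ∀ x ∈ K, m - η < g x → m + η ≤ g (Φ x) := by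
  obtain ⟨w, hwa, hwb, hwK, hw⟩ :=
    exists_continuous_ascent_target hKc hK hg ha hb hma hmb hcrit
  have hgc : Continuous g := hg.continuous
  have hcpt : IsCompact (K ∩ {x | m ≤ g x}) :=
    hKc.inter_right (isClosed_le continuous_const hgc)
  have hev : ∀ᶠ τ : ℝ in 𝓝 0, ∀ x ∈ K ∩ {x | m ≤ g x},
      0 < τ → m ≤ g x → m < g (x + τ • (w x - x)) := by
    refine hcpt.eventually_forall_of_forall_eventually fun x hx => ?_
    have hcont : Continuous fun z : ℝ × E => g (z.2 + z.1 • (w z.2 - z.2)) := by fun_prop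
    rcases (show m ≤ g x from hx.2).eq_or_lt with hxm | hxm
    · filter_upwards [eventually_lt_apply_add_smul hg w.continuous (hw x hx.1 hxm.symm)]
        with z hz hτ hm using hm.trans_lt (hz hτ)
    · filter_upwards [hcont.continuousAt.eventually (lt_mem_nhds (by simpa using hxm))]
        with z hz _ _ using hz
  obtain ⟨r, hr, hball⟩ := Metric.eventually_nhds_iff.1 hev
  obtain ⟨τ, hτ₀, hτ⟩ := exists_between (lt_min hr one_pos)
  have hΦ : Continuous fun x => x + τ • (w x - x) := by fun_prop
  have hstep : ∀ x ∈ K, m ≤ g x → m < g (x + τ • (w x - x)) := fun x hx hm =>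
    hball (by simpa [abs_of_pos hτ₀] using (lt_min_iff.1 hτ).1) x ⟨hx, hm⟩ hτ₀ hm
  obtain ⟨z, hz, hmin⟩ := hKc.exists_isMinOn ⟨a, ha⟩
    (f := fun x => max (g (x + τ • (w x - x)) - m) (m - g x)) (by fun_prop)
  refine ⟨fun x => x + τ • (w x - x), hΦ, fun x hx => ?_, by simp [hwa], by simp [hwb],
    max (g (z + τ • (w z - z)) - m) (m - g z), ?_, fun x hx hgx => ?_⟩
  · exact hK.add_smul_sub_mem hx (hwK x) ⟨hτ₀.le, (lt_min_iff.1 hτ).2.le⟩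
  · rcases le_or_gt m (g z) with h | h
    · exact lt_max_of_lt_left (sub_pos.2 (hstep z hz h))
    · exact lt_max_of_lt_right (sub_pos.2 h)
  · have h := isMinOn_iff.1 hmin x hx
    rcases le_max_iff.1 h with h | h <;> linarith

/-- **Mountain pass theorem** on a compact convex set `K`: if `a` and `b` lie strictly above a level
`M` that every connected subset of `K` joining them must reach, then `g` has a critical point
relative to `K` at a level between `M` and the minimum of `g` over the segment from `a` to `b`. -/
theorem exists_mountain_pass {K : Set E} (hKc : IsCompact K) (hK : Convex ℝ K)
    {g : E → ℝ} (hg : ContDiff ℝ 1 g) {a b : E} (ha : a ∈ K) (hb : b ∈ K) {m₀ M : ℝ}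
    (hm₀ : ∀ x ∈ segment ℝ a b, m₀ ≤ g x) (hMa : M < g a) (hMb : M < g b)
    (hM : ∀ S ⊆ K, IsPreconnected S → a ∈ S → b ∈ S → ∃ x ∈ S, g x ≤ M) :
    ∃ s ∈ K, m₀ ≤ g s ∧ g s ≤ M ∧ ∀ v ∈ K, fderiv ℝ g s (v - s) ≤ 0 := by
  let T : Set ℝ := {t | ∃ S ⊆ K, IsPreconnected S ∧ a ∈ S ∧ b ∈ S ∧ ∀ x ∈ S, t ≤ g x}
  have hT₀ : m₀ ∈ T := ⟨segment ℝ a b, hK.segment_subset ha hb,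
    (convex_segment a b).isPreconnected, left_mem_segment ℝ a b, right_mem_segment ℝ a b, hm₀⟩
  have hTM : ∀ t ∈ T, t ≤ M := by
    rintro t ⟨S, hSK, hS, haS, hbS, ht⟩
    obtain ⟨x, hx, hxM⟩ := hM S hSK hS haS hbS
    exact (ht x hx).trans hxM
  have hbdd : BddAbove T := ⟨M, hTM⟩
  have hsup : sSup T ≤ M := csSup_le ⟨m₀, hT₀⟩ hTM
  by_contra! hcon
  obtain ⟨Φ, hΦ, hΦK, hΦa, hΦb, η, hη, hup⟩ := exists_continuous_deformation hKc hK hg ha hb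
    (m := sSup T) (by linarith) (by linarith) fun s hs hsm =>
      hcon s hs (hsm ▸ le_csSup hbdd hT₀) (hsm ▸ hsup)
  obtain ⟨t, ⟨S, hSK, hS, haS, hbS, ht⟩, hlt⟩ :=
    exists_lt_of_lt_csSup ⟨m₀, hT₀⟩ (sub_lt_self (sSup T) hη)
  have hmem : sSup T + η ∈ T := by
    refine ⟨Φ '' S, ?_, hS.image Φ hΦ.continuousOn, ⟨a, haS, hΦa⟩, ⟨b, hbS, hΦb⟩, ?_⟩
    · rintro _ ⟨x, hx, rfl⟩
      exact hΦK (hSK hx)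
    · rintro _ ⟨x, hx, rfl⟩
      exact hup x (hSK hx) (hlt.trans_le (ht x hx))
  linarith [le_csSup hbdd hmem]

/-- If an isolated critical point `a` is a local maximum, then any other point where `g`
is at least as large is separated from it by a valley, relative to critical points in a
neighborhood `U` of `a`. -/
theorem IsLocalMax.exists_valley [ProperSpace E] {g : E → ℝ} (hg : Continuous g) {a b : E}
    (hmax : IsLocalMax g a) {U : Set E} (hU : U ∈ 𝓝 a)
    (huniq : ∀ q ∈ U, fderiv ℝ g q = 0 → q = a) (hab : g a < g b) :
    ∃ M < g a, ∀ S : Set E, IsPreconnected S → a ∈ S → b ∈ S → ∃ x ∈ S, g x ≤ M := by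
  obtain ⟨r, hr, hball⟩ := Metric.mem_nhds_iff.1 (inter_mem hU hmax)
  have hcross : ∀ S : Set E, IsPreconnected S → a ∈ S → b ∈ S →
      ∃ x ∈ S, x ∈ sphere a (r / 2) := by
    intro S hS haS hbS
    have hb : r ≤ dist b a := by
      by_contra! h
      exact absurd (hball h).2 (not_le.2 hab)
    exact hS.intermediate_value haS hbS (f := fun x => dist x a) (by fun_prop)
      ⟨by simp only [dist_self]; positivity, by linarith⟩
  obtain ⟨y, -, hy⟩ := hcross Set.univ isPreconnected_univ trivial trivial
  obtain ⟨z, hz, hzmax⟩ := (isCompact_sphere a (r / 2)).exists_isMaxOn ⟨y, hy⟩ hg.continuousOn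
  have hza : z ∈ ball a r := by
    rw [mem_ball, mem_sphere.1 hz]
    linarith
  refine ⟨g z, lt_of_le_of_ne (hball hza).2 fun heq => ?_, fun S hS haS hbS => ?_⟩
  · have hzloc : IsLocalMax g z := by
      filter_upwards [isOpen_ball.mem_nhds hza] with x hx
      rw [heq]
      exact (hball hx).2
    have := huniq z (hball hza).1 hzloc.fderiv_eq_zero
    rw [this, mem_sphere, dist_self] at hz
    linarith
  · obtain ⟨x, hx, hxs⟩ := hcross S hS haS hbS
    exact ⟨x, hx, isMaxOn_iff.1 hzmax x hxs⟩

end MountainPass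

/-- A critical point of `f` relative to a closed ball either is a critical point of `f`, or
lies on the boundary sphere, with radial gradient. -/
theorem gradient_eq_zero_or_radial {F : Type*} [NormedAddCommGroup F] [InnerProductSpace ℝ F]
    [CompleteSpace F] {f : F → ℝ} {p s : F} {δ : ℝ} (hδ : 0 < δ) (hs : s ∈ closedBall p δ)
    (hcrit : ∀ v ∈ closedBall p δ, fderiv ℝ f s (v - s) ≤ 0) :
    fderiv ℝ f s = 0 ∨ s ∈ sphere p δ ∧ ∃ k : ℝ, gradient f s = k • (s - p) := by
  refine or_iff_not_imp_left.2 fun hne => ?_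
  set G := gradient f s with hG
  have hGne : G ≠ 0 := by
    simpa [hG, gradient] using hne
  have hGpos : 0 < ‖G‖ := norm_pos_iff.2 hGne
  have hGv : ∀ v, fderiv ℝ f s v = inner ℝ G v := fun v =>
    (InnerProductSpace.toDual_symm_apply (𝕜 := ℝ)).symm
  have hsδ : ‖s - p‖ ≤ δ := by simpa [dist_eq_norm] using hs
  have h := hcrit (p + (δ / ‖G‖) • G) (by
    simp [norm_smul, abs_of_pos hδ, div_mul_cancel₀ _ hGpos.ne'])
  have e : p + (δ / ‖G‖) • G - s = (δ / ‖G‖) • G - (s - p) := by abel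
  rw [hGv, e, inner_sub_right, inner_smul_right, real_inner_self_eq_norm_sq, pow_two,
    ← mul_assoc, div_mul_cancel₀ _ hGpos.ne'] at h
  have hcs := real_inner_le_norm G (s - p)
  have hsp : ‖s - p‖ = δ := by
    refine le_antisymm hsδ (le_of_mul_le_mul_left ?_ hGpos)
    linarith
  refine ⟨by rwa [mem_sphere, dist_eq_norm], ‖G‖ / δ, ?_⟩
  have hin : inner ℝ G (s - p) = ‖G‖ * ‖s - p‖ := by
    refine le_antisymm hcs ?_
    rw [hsp]
    linarith
  have := inner_eq_norm_mul_iff_real.1 hin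
  rw [hsp] at this
  rw [div_eq_inv_mul, mul_smul, ← this, smul_smul, inv_mul_cancel₀ hδ.ne', one_smul]

/-- If `f` is a `C¹`-limit of functions with unique critical points, which are local maxima tending
to `p`, and `p` is not a local maximum of `f`, then some point of the sphere around `p` is almost
critical for `f` relative to the ball and almost at level `f p`. -/
theorem exists_almost_critical_on_sphere {D : ℕ} {δ : ℝ} (hδ : 0 < δ)
    {p : EuclideanSpace ℝ (Fin D)} {f : EuclideanSpace ℝ (Fin D) → ℝ} (hf : Continuous f)
    (hsaddle : ∀ U ∈ 𝓝 p, ∃ s ∈ U, f p < f s)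
    {fn : ℕ → EuclideanSpace ℝ (Fin D) → ℝ} (hfn : ∀ n, ContDiff ℝ 1 (fn n))
    (hconv : TendstoUniformlyOn fn f atTop (closedBall p δ))
    (hconv' : TendstoUniformlyOn (fun n s => fderiv ℝ (fn n) s) (fderiv ℝ f) atTop
      (closedBall p δ))
    {pn : ℕ → EuclideanSpace ℝ (Fin D)} (hpn : Tendsto pn atTop (𝓝 p))
    (huniq : ∀ n, ∀ q ∈ closedBall p δ, fderiv ℝ (fn n) q = 0 → q = pn n)
    (hpnmax : ∀ n, IsLocalMax (fn n) (pn n)) {η : ℝ} (hη : 0 < η) :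
    ∃ s ∈ sphere p δ, |f s - f p| ≤ η ∧
      ∀ v ∈ closedBall p δ, fderiv ℝ f s (v - s) ≤ η := by
  obtain ⟨r, hr, hrδ, hrη⟩ : ∃ r > 0, r < δ ∧ ∀ x ∈ ball p r, |f x - f p| < η / 4 := by
    obtain ⟨r, hr, h⟩ := Metric.continuousAt_iff.1 hf.continuousAt (η / 4) (by positivity)
    exact ⟨min r (δ / 2), by positivity, (min_le_right _ _).trans_lt (by linarith),
      fun x hx => h (lt_of_lt_of_le hx (min_le_left _ _))⟩
  have hrK : ball p r ⊆ closedBall p δ := ball_subset_closedBall.trans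
    (closedBall_subset_closedBall hrδ.le)
  obtain ⟨b, hb, hfb⟩ := hsaddle _ (ball_mem_nhds p hr)
  set γ := f b - f p with hγ
  have hγ₀ : 0 < γ := sub_pos.2 hfb
  have hfpn : ∀ᶠ n in atTop, |f (pn n) - f p| < γ / 3 :=
    ((hf.tendsto p).comp hpn).eventually (ball_mem_nhds _ (by positivity : 0 < γ / 3))
  obtain ⟨n, hn₁, hn₂, hn₃, hn₄, hn₅⟩ := ((hpn.eventually (ball_mem_nhds p hr)).and
    (hfpn.and ((Metric.tendstoUniformlyOn_iff.1 hconv (γ / 3) (by positivity)).and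
    ((Metric.tendstoUniformlyOn_iff.1 hconv (η / 4) (by positivity)).and
    (Metric.tendstoUniformlyOn_iff.1 hconv' (η / (2 * δ)) (by positivity)))))).exists
  have hpK : pn n ∈ closedBall p δ := hrK hn₁
  have hab : fn n (pn n) < fn n b := by
    have h₁ := abs_lt.1 (hn₃ _ hpK)
    have h₂ := abs_lt.1 (hn₃ _ (hrK hb))
    have h₃ := abs_lt.1 hn₂
    linarith [h₁.1, h₂.2, h₃.2]
  obtain ⟨M, hM, hval⟩ := (hpnmax n).exists_valley (hfn n).continuous
    (mem_of_superset (isOpen_ball.mem_nhds hn₁) hrK) (huniq n) hab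
  have hclose : ∀ x ∈ ball p r, |fn n x - f p| < η / 2 := by
    intro x hx
    have h₁ := abs_lt.1 (hn₄ _ (hrK hx))
    have h₂ := abs_lt.1 (hrη x hx)
    exact abs_lt.2 ⟨by linarith [h₁.2, h₂.1], by linarith [h₁.1, h₂.2]⟩
  obtain ⟨s, hs, hs₁, hs₂, hcrit⟩ := exists_mountain_pass (isCompact_closedBall p δ)
    (convex_closedBall p δ) (hfn n) hpK (hrK hb) (m₀ := f p - η / 2)
    (fun x hx => by
      have := abs_lt.1 (hclose x ((convex_ball p r).segment_subset hn₁ hb hx))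
      linarith [this.1])
    hM (hM.trans hab) (fun S _ => hval S)
  have hsphere : s ∈ sphere p δ := by
    rcases gradient_eq_zero_or_radial hδ hs hcrit with h | h
    · rw [huniq n s hs h] at hs₂
      exact absurd hs₂ (not_le.2 hM)
    · exact h.1
  refine ⟨s, hsphere, ?_, fun v hv => ?_⟩
  · have h₁ := abs_lt.1 (hn₄ _ hs)
    have h₂ := abs_lt.1 (hclose _ hn₁)
    exact abs_le.2 ⟨by linarith [h₁.1], by linarith [h₁.2, h₂.2]⟩
  · have h₁ : ‖fderiv ℝ f s - fderiv ℝ (fn n) s‖ ≤ η / (2 * δ) := by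
      simpa [dist_eq_norm] using (hn₅ s hs).le
    have h₂ : ‖v - s‖ ≤ 2 * δ := by
      rw [← dist_eq_norm]
      linarith [dist_triangle_right v s p, mem_closedBall.1 hv, mem_closedBall.1 hs]
    have h₃ := (fderiv ℝ f s - fderiv ℝ (fn n) s).le_of_opNorm_le_of_le h₁ h₂
    rw [div_mul_cancel₀ _ (by positivity), Real.norm_eq_abs,
      sub_apply] at h₃
    linarith [(abs_le.1 h₃).2, hcrit v hv]

open Filter Topology Metric

/-- a sequence of unique local maxima of `fₙ` converging in `C¹` cannot
limit onto a saddle point of `f` whose level set cuts the sphere `∂B_δ(p)` transversally.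
Saddle point: a critical point such that every neighborhood contains points with larger
and points with smaller values. -/
theorem stmt18 {D : ℕ} (ε δ : ℝ) (hδ : δ ∈ Set.Ioo 0 ε)
    (p : EuclideanSpace ℝ (Fin D))
    (f : EuclideanSpace ℝ (Fin D) → ℝ) (hf : ContDiff ℝ 1 f)
    (hcrit : fderiv ℝ f p = 0)
    (hsaddle : ∀ U ∈ nhds p, (∃ s ∈ U, f p < f s) ∧ (∃ s ∈ U, f s < f p))
    (htrans : ∀ s ∈ sphere p δ, f s = f p →
      ¬ ∃ k : ℝ, gradient f s = k • (s - p))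
    (fn : ℕ → EuclideanSpace ℝ (Fin D) → ℝ) (hfn : ∀ n, ContDiff ℝ 1 (fn n))
    (hconv : TendstoUniformlyOn fn f atTop (closedBall p ε))
    (hconv' : TendstoUniformlyOn (fun n s => fderiv ℝ (fn n) s) (fderiv ℝ f) atTop
      (closedBall p ε))
    (pn : ℕ → EuclideanSpace ℝ (Fin D)) (hpn : Tendsto pn atTop (nhds p))
    (hpncrit : ∀ n, pn n ∈ closedBall p δ ∧ fderiv ℝ (fn n) (pn n) = 0 ∧
      ∀ q ∈ closedBall p δ, fderiv ℝ (fn n) q = 0 → q = pn n)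
    (hpnmax : ∀ n, IsLocalMax (fn n) (pn n)) :
    False := by
  have hδ₀ : 0 < δ := hδ.1
  have hsub : closedBall p δ ⊆ closedBall p ε := closedBall_subset_closedBall hδ.2.le
  have hη : ∀ k : ℕ, (0 : ℝ) < 1 / ((k : ℝ) + 1) := fun k => Nat.one_div_pos_of_nat
  choose s hs hlevel happrox using fun k => exists_almost_critical_on_sphere hδ₀ hf.continuous
    (fun U hU => (hsaddle U hU).1) hfn (hconv.mono hsub) (hconv'.mono hsub) hpn
    (fun n => (hpncrit n).2.2) hpnmax (hη k)
  obtain ⟨q, hq, φ, hφ, hlim⟩ := (isCompact_sphere p δ).tendsto_subseq hs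
  have hη₀ : Tendsto (fun k => 1 / ((φ k : ℝ) + 1)) atTop (𝓝 0) :=
    tendsto_one_div_add_atTop_nhds_zero_nat.comp hφ.tendsto_atTop
  have hf' : Continuous (fderiv ℝ f) := hf.continuous_fderiv one_ne_zero
  have hfq : f q = f p := by
    have hcont : Continuous fun x => |f x - f p| := by
      have := hf.continuous
      fun_prop
    have h := le_of_tendsto_of_tendsto' ((hcont.tendsto q).comp hlim) hη₀
      fun k => hlevel (φ k)
    exact sub_eq_zero.1 (abs_nonpos_iff.1 h)
  have hcritq : ∀ v ∈ closedBall p δ, fderiv ℝ f q (v - q) ≤ 0 := by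
    intro v hv
    have hcont : Continuous fun x => fderiv ℝ f x (v - x) := by fun_prop
    exact le_of_tendsto_of_tendsto' ((hcont.tendsto q).comp hlim) hη₀
      fun k => happrox (φ k) v hv
  refine htrans q hq hfq ?_
  rcases gradient_eq_zero_or_radial hδ₀ (sphere_subset_closedBall hq) hcritq with h | h
  · exact ⟨0, by simp [gradient, h]⟩
  · exact h.2
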